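/- arXiv:1501.00162 — 10 statements merged into one kernel-verified Lean document; each statement's English description precedes it below -/
import Mathlib

section
/- Let p be a prime, let m be a positive integer with m ≤ p, and let x, y, z ∈ [p] be three pairwise distinct elements. Then for all prescribed images i_x, i_y, i_z ∈ [m] there exists an element d ∈ [p] with d > 1 such that the number of pairs (a, b) ∈ [p]² with h_{a,b}(x) = i_x, h_{a,b}(y) = i_y and h_{a,b}(z) = i_z equals the number of pairs (a, b) ∈ [p]² with h_{a,b}(0) = i_x, h_{a,b}(1) = i_y and h_{a,b}(d) = i_z. Equivalently, for a uniformly random pair (a, b) ∈ [p]², P[h(x) = i_x, h(y) = i_y, h(z) = i_z] = P[h(0) = i_x, h(1) = i_y, h(d) = i_z]. -/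
/-- The simple linear hash function `h_{a,b}(x) = ((a·x + b) mod p) mod m`. -/
def hab (p m a b x : ℕ) : ℕ := ((a * x + b) % p) % m

theorem hab_eq_val_zmod (p m a b x : ℕ) :
    hab p m a b x = ((a : ZMod p) * x + b).val % m := by
  have h : ((a : ZMod p) * x + b) = ((a * x + b : ℕ) : ZMod p) := by push_cast; rfl
  rw [h, ZMod.val_natCast, hab]

/-- **Transformation lemma.**  For a prime `p`, `0 < m ≤ p`, pairwise distinct
`x, y, z ∈ [p]` and prescribed images `i_x, i_y, i_z ∈ [m]`, there exists `d ∈ [p]`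
with `d > 1` such that the number of pairs `(a, b) ∈ [p]²` mapping `x, y, z` to
`i_x, i_y, i_z` equals the number of pairs mapping `0, 1, d` to `i_x, i_y, i_z`. -/
theorem transformation_lemma (p m x y z ix iy iz : ℕ)
    (hp : p.Prime) (hm : 0 < m) (hmp : m ≤ p)
    (hx : x < p) (hy : y < p) (hz : z < p)
    (hxy : x ≠ y) (hxz : x ≠ z) (hyz : y ≠ z)
    (hix : ix < m) (hiy : iy < m) (hiz : iz < m) :
    ∃ d : ℕ, d < p ∧ 1 < d ∧
      (((Finset.range p) ×ˢ (Finset.range p)).filter (fun ab =>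
          hab p m ab.1 ab.2 x = ix ∧ hab p m ab.1 ab.2 y = iy ∧
            hab p m ab.1 ab.2 z = iz)).card =
      (((Finset.range p) ×ˢ (Finset.range p)).filter (fun ab =>
          hab p m ab.1 ab.2 0 = ix ∧ hab p m ab.1 ab.2 1 = iy ∧
            hab p m ab.1 ab.2 d = iz)).card := by
  have : Fact p.Prime := ⟨hp⟩
  have cast_ne : ∀ {u v : ℕ}, u < p → v < p → u ≠ v → (u : ZMod p) - v ≠ 0 := by
    intro u v hu hv huv h
    apply huv
    have h' := congrArg ZMod.val (sub_eq_zero.mp h)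
    rwa [ZMod.val_natCast_of_lt hu, ZMod.val_natCast_of_lt hv] at h'
  have hc : (y : ZMod p) - x ≠ 0 := cast_ne hy hx hxy.symm
  have hzx : (z : ZMod p) - x ≠ 0 := cast_ne hz hx hxz.symm
  have hzy : (z : ZMod p) - y ≠ 0 := cast_ne hz hy hyz.symm
  set c : ZMod p := y - x with hcdef
  set d : ZMod p := (z - x) / c with hd
  have hcd : c * d = z - x := by rw [hd]; field_simp
  have hd0 : d ≠ 0 := div_ne_zero hzx hc
  have hd1 : d ≠ 1 := by
    intro h
    apply hzy
    rw [h, hcdef] at hcd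
    linear_combination -hcd
  refine ⟨d.val, d.val_lt, ?_, ?_⟩
  · have h0 : d.val ≠ 0 := by rwa [Ne, ZMod.val_eq_zero]
    have h1 : d.val ≠ 1 := by
      intro h
      apply hd1
      rw [← ZMod.natCast_zmod_val d, h, Nat.cast_one]
    omega
  · simp only [hab_eq_val_zmod]
    refine Finset.card_nbij'
      (fun ab => (((ab.1 : ZMod p) * c).val, ((ab.1 : ZMod p) * x + ab.2).val))
      (fun ab => (((ab.1 : ZMod p) / c).val, ((ab.2 : ZMod p) - ab.1 / c * x).val))
      ?_ ?_ ?_ ?_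
    · rintro ⟨a, b⟩ hmem
      simp only [Finset.coe_filter, Finset.mem_product, Finset.mem_range, Set.mem_ofPred_eq,
        ZMod.natCast_val, ZMod.cast_id', id_eq, ZMod.val_lt, true_and, and_self, Nat.cast_zero,
        Nat.cast_one, mul_zero, zero_add, mul_one] at hmem ⊢
      have e1 : (a : ZMod p) * c + (a * x + b) = a * y + b := by rw [hcdef]; ring
      have e2 : (a : ZMod p) * c * d + (a * x + b) = a * z + b := by
        linear_combination (a : ZMod p) * hcd
      rw [e1, e2]
      exact hmem.2
    · rintro ⟨a, b⟩ hmem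
      simp only [Finset.coe_filter, Finset.mem_product, Finset.mem_range, Set.mem_ofPred_eq,
        ZMod.natCast_val, ZMod.cast_id', id_eq, ZMod.val_lt, true_and, and_self, Nat.cast_zero,
        Nat.cast_one, mul_zero, zero_add, mul_one] at hmem ⊢
      have hac : (a : ZMod p) / c * c = a := div_mul_cancel₀ _ hc
      have e0 : (a : ZMod p) / c * x + (b - a / c * x) = b := by ring
      have e1 : (a : ZMod p) / c * y + (b - a / c * x) = a + b := by
        linear_combination hac - (a : ZMod p) / c * hcdef
      have e2 : (a : ZMod p) / c * z + (b - a / c * x) = a * d + b := by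
        linear_combination d * hac - (a : ZMod p) / c * hcd
      rw [e0, e1, e2]
      exact hmem.2
    · rintro ⟨a, b⟩ hmem
      simp only [Finset.coe_filter, Finset.mem_product, Finset.mem_range,
        Set.mem_ofPred_eq] at hmem
      simp [mul_div_cancel_right₀ _ hc, ZMod.val_natCast_of_lt hmem.1.1,
        ZMod.val_natCast_of_lt hmem.1.2]
    · rintro ⟨a, b⟩ hmem
      simp only [Finset.coe_filter, Finset.mem_product, Finset.mem_range,
        Set.mem_ofPred_eq] at hmem
      simp [div_mul_cancel₀ _ hc, ZMod.val_natCast_of_lt hmem.1.1,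
        ZMod.val_natCast_of_lt hmem.1.2]
end

section
/- There is an absolute constant C > 0 such that the following holds. Let p be a prime, let m be a positive integer with m ≤ p, and let d be an integer with 2 ≤ d < p/m. For a uniformly random pair (a, b) ∈ [p]², the probability that all elements of the interval [d] = {0, 1, ..., d−1} are mapped by h_{a,b} to a single value, i.e. |h_{a,b}([d])| = 1, is at most 1/((d−1)·m) + 1/m² + C/p. -/
/-- The orbit `x ↦ (a * x + b) % p` either steps up by `a` or steps down by `p - a`. -/
theorem mod_step {p a b : ℕ} (ha : a < p) (x : ℕ) :
    (a * (x + 1) + b) % p = (a * x + b) % p + a ∨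
      (a * (x + 1) + b) % p + (p - a) = (a * x + b) % p := by
  have hlt : (a * x + b) % p < p := Nat.mod_lt _ (by omega)
  have h : (a * (x + 1) + b) % p = ((a * x + b) % p + a) % p := by
    rw [Nat.mod_add_mod]
    congr 1
    ring
  rw [h]
  rcases lt_or_ge ((a * x + b) % p + a) p with h1 | h1
  · exact Or.inl (Nat.mod_eq_of_lt h1)
  · right
    rw [Nat.mod_eq_sub_mod h1, Nat.mod_eq_of_lt (by omega)]
    omega

/-- If `h_{a,b}` is constant on `{0, …, n}`, then the orbit never wraps around and `m ∣ a`,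
or it wraps around at every step and `m ∣ p - a`. -/
theorem hab_const_imp {p m n a b : ℕ} (hmp : ¬ m ∣ p) (hn : 0 < n) (ha : a < p) (hb : b < p)
    (h : ∀ x ≤ n, hab p m a b x = hab p m a b 0) :
    (m ∣ a ∧ n * a + b < p) ∨ (a ≠ 0 ∧ m ∣ p - a ∧ n * (p - a) ≤ b) := by
  have hmod : ∀ x, x + 1 ≤ n → (a * x + b) % p ≡ (a * (x + 1) + b) % p [MOD m] := fun x hx =>
    (h x (by omega)).trans (h (x + 1) hx).symm
  have hup : ∀ x, x + 1 ≤ n → (a * (x + 1) + b) % p = (a * x + b) % p + a → m ∣ a := by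
    intro x hx e
    have := hmod x hx
    rw [e] at this
    simpa using (Nat.modEq_iff_dvd' (Nat.le_add_right _ _)).1 this
  have hdown : ∀ x, x + 1 ≤ n → (a * (x + 1) + b) % p + (p - a) = (a * x + b) % p →
      m ∣ p - a := by
    intro x hx e
    have := (hmod x hx).symm
    rw [← e] at this
    simpa using (Nat.modEq_iff_dvd' (Nat.le_add_right _ _)).1 this
  by_cases hma : m ∣ a
  · left
    have hnot : ¬ m ∣ p - a := fun h' => hmp (by
      have := Nat.dvd_add h' hma
      rwa [Nat.sub_add_cancel ha.le] at this)
    have key : ∀ x ≤ n, (a * x + b) % p = x * a + b := by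
      intro x
      induction x with
      | zero => intro _; simpa using Nat.mod_eq_of_lt hb
      | succ x ih =>
        intro hx
        rcases mod_step (b := b) ha x with e | e
        · rw [e, ih (by omega)]
          ring
        · exact absurd (hdown x hx e) hnot
    exact ⟨hma, key n le_rfl ▸ Nat.mod_lt _ (by omega)⟩
  · right
    have key : ∀ x ≤ n, (a * x + b) % p + x * (p - a) = b := by
      intro x
      induction x with
      | zero => intro _; simpa using Nat.mod_eq_of_lt hb
      | succ x ih =>
        intro hx
        rcases mod_step (b := b) ha x with e | e
        · exact absurd (hup x hx e) hma
        · have := ih (by omega)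
          rw [← e] at this
          linarith
    refine ⟨fun h0 => hma (h0 ▸ dvd_zero m), ?_, by have := key n le_rfl; omega⟩
    rcases mod_step (b := b) ha 0 with e | e
    · exact absurd (hup 0 hn e) hma
    · exact hdown 0 hn e

theorem two_mul_sum_tsub_le (p L n : ℕ) :
    2 * L * ∑ k ∈ Finset.range n, (p - L * (k + 1)) ≤ p ^ 2 := by
  suffices h : 2 * L * ∑ k ∈ Finset.range n, (p - L * (k + 1)) + (p - L * n) ^ 2 ≤ p ^ 2 by
    omega
  induction n with
  | zero => simp
  | succ n ih =>
    rw [Finset.sum_range_succ]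
    have step : 2 * L * (p - L * (n + 1)) + (p - L * (n + 1)) ^ 2 ≤ (p - L * n) ^ 2 := by
      rcases le_total p (L * (n + 1)) with h | h
      · simp [Nat.sub_eq_zero_of_le h]
      · have e : p - L * n = (p - L * (n + 1)) + L := by
          rw [mul_add, mul_one] at h ⊢
          omega
        rw [e]
        nlinarith
    linarith

/-- The number of pairs `(a, b)` for which `h_{a,b}` is constant on `{0, …, n}`. -/
theorem card_hab_const_le {p m n : ℕ} (hmp : ¬ m ∣ p) (hm : 0 < m) (hn : 0 < n) :
    n * m * (((Finset.range p) ×ˢ (Finset.range p)).filter (fun ab =>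
      ∀ x ≤ n, hab p m ab.1 ab.2 x = hab p m ab.1 ab.2 0)).card ≤ p ^ 2 + n * m * p := by
  set L := n * m with hL
  let A := (Finset.range (p + 1)).sigma fun k => Finset.range (p - L * k)
  let B := (Finset.range p).sigma fun k => Finset.range (p - L * (k + 1))
  have hsub : ((Finset.range p) ×ˢ (Finset.range p)).filter (fun ab =>
      ∀ x ≤ n, hab p m ab.1 ab.2 x = hab p m ab.1 ab.2 0) ⊆
      A.image (fun q => (m * q.1, q.2)) ∪
        B.image (fun q => (p - m * (q.1 + 1), p - 1 - q.2)) := by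
    rintro ⟨a, b⟩ hmem
    simp only [Finset.mem_filter, Finset.mem_product, Finset.mem_range] at hmem
    obtain ⟨⟨ha, hb⟩, hc⟩ := hmem
    rw [Finset.mem_union, Finset.mem_image, Finset.mem_image]
    rcases hab_const_imp hmp hn ha hb hc with ⟨⟨k, rfl⟩, hlt⟩ | ⟨ha0, ⟨k, hk⟩, hle⟩
    · left
      refine ⟨⟨k, b⟩, ?_, rfl⟩
      have h1 : k ≤ m * k := Nat.le_mul_of_pos_left k hm
      simp only [A, Finset.mem_sigma, Finset.mem_range]
      rw [← mul_assoc, ← hL] at hlt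
      omega
    · right
      obtain _ | k := k
      · omega
      refine ⟨⟨k, p - 1 - b⟩, ?_, ?_⟩
      · have h1 : k + 1 ≤ m * (k + 1) := Nat.le_mul_of_pos_left _ hm
        simp only [B, Finset.mem_sigma, Finset.mem_range]
        rw [hk, ← mul_assoc, ← hL] at hle
        omega
      · simp only [Prod.mk.injEq]
        omega
  have hA : A.card = p + ∑ k ∈ Finset.range p, (p - L * (k + 1)) := by
    simp [A, Finset.card_sigma, Finset.sum_range_succ', add_comm]
  have hB : B.card = ∑ k ∈ Finset.range p, (p - L * (k + 1)) := by
    simp [B, Finset.card_sigma]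
  have hcard := (Finset.card_le_card hsub).trans ((Finset.card_union_le _ _).trans
    (add_le_add Finset.card_image_le Finset.card_image_le))
  rw [hA, hB] at hcard
  have := two_mul_sum_tsub_le p L p
  have := Nat.mul_le_mul_left L hcard
  linarith

/-- **Collision probability of a whole interval.**  There is an absolute constant
`C > 0` such that for every prime `p`, every `0 < m ≤ p` and every integer `d` with
`2 ≤ d < p/m`, the probability (over a uniform pair `(a, b) ∈ [p]²`) that all
elements of `[d] = {0, …, d−1}` are mapped by `h_{a,b}` to a single value is at most
`1/((d−1)·m) + 1/m² + C/p`. -/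
theorem interval_collision_probability :
    ∃ C : ℝ, 0 < C ∧ ∀ p m d : ℕ, p.Prime → 0 < m → m ≤ p → 2 ≤ d →
      (d : ℝ) < (p : ℝ) / m →
      ((((Finset.range p) ×ˢ (Finset.range p)).filter (fun ab =>
          ((Finset.range d).image (fun x => hab p m ab.1 ab.2 x)).card = 1)).card : ℝ)
          / (p : ℝ) ^ 2 ≤
        1 / (((d : ℝ) - 1) * m) + 1 / (m : ℝ) ^ 2 + C / p := by
  refine ⟨1, one_pos, fun p m d hp hm hmp hd hdp => ?_⟩
  have hp0 : (0 : ℝ) < p := by exact_mod_cast hp.pos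
  have hm0 : (0 : ℝ) < m := by exact_mod_cast hm
  obtain ⟨n, rfl⟩ : ∃ n, d = n + 1 := ⟨d - 1, by omega⟩
  have hn : 0 < n := by omega
  have hn0 : (0 : ℝ) < n := by exact_mod_cast hn
  push_cast
  rw [add_sub_cancel_right]
  by_cases hdvd : m ∣ p
  · rcases (Nat.dvd_prime hp).1 hdvd with rfl | rfl
    · have hle : ((((Finset.range p) ×ˢ (Finset.range p)).filter (fun ab =>
          ((Finset.range (n + 1)).image (fun x => hab p 1 ab.1 ab.2 x)).card = 1)).card : ℝ)
          / (p : ℝ) ^ 2 ≤ 1 := by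
        rw [div_le_one (by positivity)]
        have := Finset.card_filter_le ((Finset.range p) ×ˢ (Finset.range p)) (fun ab =>
          ((Finset.range (n + 1)).image (fun x => hab p 1 ab.1 ab.2 x)).card = 1)
        rw [Finset.card_product, Finset.card_range, ← sq] at this
        exact_mod_cast this
      have h1 : (0 : ℝ) ≤ 1 / (n * (1 : ℕ)) := by positivity
      have h2 : (0 : ℝ) ≤ 1 / p := by positivity
      have h3 : (1 : ℝ) / ((1 : ℕ) : ℝ) ^ 2 = 1 := by norm_num
      linarith
    · rw [div_self hp0.ne'] at hdp
      push_cast at hdp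
      linarith
  · have hsub : ((Finset.range p) ×ˢ (Finset.range p)).filter (fun ab =>
          ((Finset.range (n + 1)).image (fun x => hab p m ab.1 ab.2 x)).card = 1) ⊆
        ((Finset.range p) ×ˢ (Finset.range p)).filter (fun ab =>
          ∀ x ≤ n, hab p m ab.1 ab.2 x = hab p m ab.1 ab.2 0) := by
      refine Finset.monotone_filter_right _ fun ab _ hc x hx => ?_
      exact Finset.card_le_one.1 hc.le _
        (Finset.mem_image_of_mem _ (Finset.mem_range.2 (by omega))) _
        (Finset.mem_image_of_mem _ (Finset.mem_range.2 (by omega)))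
    have hcard := (Nat.mul_le_mul_left (n * m) (Finset.card_le_card hsub)).trans
      (card_hab_const_le hdvd hm hn)
    have hcard' : (n : ℝ) * m * ((((Finset.range p) ×ˢ (Finset.range p)).filter (fun ab =>
        ((Finset.range (n + 1)).image (fun x => hab p m ab.1 ab.2 x)).card = 1)).card : ℝ) ≤
        (p : ℝ) ^ 2 + n * m * p := by exact_mod_cast hcard
    have hsq : (0 : ℝ) ≤ 1 / (m : ℝ) ^ 2 := by positivity
    suffices h : ((((Finset.range p) ×ˢ (Finset.range p)).filter (fun ab =>
        ((Finset.range (n + 1)).image (fun x => hab p m ab.1 ab.2 x)).card = 1)).card : ℝ)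
        / (p : ℝ) ^ 2 ≤ 1 / (n * m) + 1 / p by linarith
    have e : (1 : ℝ) / (n * m) + 1 / p = ((p : ℝ) ^ 2 + n * m * p) / (n * m) / p ^ 2 := by
      field_simp
    rw [e]
    gcongr
    rw [le_div_iff₀ (by positivity)]
    linarith
end

section
/- Let p be a prime and m a positive integer with p > 3m², and let d be an integer with 2 ≤ d ≤ m. For a uniformly random pair (a, b) ∈ [p]², the probability that all elements of {0, 1, ..., d−1} are mapped by h_{a,b} to a single value is at least 1/(6·d·m). -/
theorem hab_mul_eq_of_lt {p m k b x : ℕ} (h : m * k * x + b < p) :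
    hab p m (m * k) b x = b % m := by
  rw [hab, Nat.mod_eq_of_lt h, mul_assoc, Nat.mul_add_mod]

theorem card_image_hab_mul_eq_one {p m d k b : ℕ} (hd : 0 < d)
    (hk : m * k * (2 * d) ≤ p) (hb : 2 * b < p) :
    ((Finset.range d).image (fun x => hab p m (m * k) b x)).card = 1 := by
  rw [Finset.card_eq_one]
  refine ⟨b % m, ?_⟩
  rw [Finset.image_congr (g := fun _ => b % m),
    Finset.image_const (Finset.nonempty_range_iff.2 hd.ne')]
  intro x hx
  have hx : x < d := by simpa using hx
  have hle : m * k * x ≤ m * k * d := Nat.mul_le_mul_left _ hx.le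
  exact hab_mul_eq_of_lt (by linarith)

/-- **Lower bound on the collision probability.**  For a prime `p` and a positive
integer `m` with `p > 3m²`, and an integer `d` with `2 ≤ d ≤ m`, the probability
(over a uniform pair `(a, b) ∈ [p]²`) that all elements of `{0, 1, …, d−1}` are
mapped by `h_{a,b}` to a single value is at least `1/(6·d·m)`. -/
theorem interval_collision_probability_lower_bound
    (p m d : ℕ) (hp : p.Prime) (hm : 0 < m) (hpm : 3 * m ^ 2 < p)
    (hd2 : 2 ≤ d) (hdm : d ≤ m) :
    1 / (6 * (d : ℝ) * m) ≤
      ((((Finset.range p) ×ˢ (Finset.range p)).filter (fun ab =>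
          ((Finset.range d).image (fun x => hab p m ab.1 ab.2 x)).card = 1)).card : ℝ)
        / (p : ℝ) ^ 2 := by
  have hd : 0 < d := by omega
  have hp0 : 0 < p := hp.pos
  have hcard : (p / (2 * d * m) + 1) * ((p + 1) / 2) ≤
      (((Finset.range p) ×ˢ (Finset.range p)).filter (fun ab =>
        ((Finset.range d).image (fun x => hab p m ab.1 ab.2 x)).card = 1)).card := by
    rw [← Finset.card_range (p / (2 * d * m) + 1), ← Finset.card_range ((p + 1) / 2),
      ← Finset.card_product]
    refine Finset.card_le_card_of_injOn (fun kb => (m * kb.1, kb.2)) ?_ ?_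
    · rintro ⟨k, b⟩ hkb
      simp only [Finset.coe_product, Finset.coe_range, Set.mem_prod, Set.mem_Iio] at hkb
      obtain ⟨hk, hb⟩ := hkb
      have hk' : m * k * (2 * d) ≤ p := by
        have := (Nat.le_div_iff_mul_le (by positivity)).1 (Nat.lt_succ_iff.1 hk)
        linarith
      simp only [Finset.coe_filter, Finset.mem_product, Finset.mem_range, Set.mem_ofPred_eq]
      exact ⟨⟨by nlinarith, by omega⟩, card_image_hab_mul_eq_one hd hk' (by omega)⟩
    · rintro ⟨k, b⟩ - ⟨k', b'⟩ - h
      simpa [hm.ne'] using h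
  have hK : (p : ℝ) / (2 * d * m) ≤ (p / (2 * d * m) + 1 : ℕ) := by
    have := (Nat.lt_floor_add_one ((p : ℝ) / ((2 * d * m : ℕ) : ℝ))).le
    rw [Nat.floor_div_natCast, Nat.floor_natCast] at this
    exact_mod_cast this
  have hB : (p : ℝ) / 2 ≤ ((p + 1) / 2 : ℕ) := by
    rw [div_le_iff₀ two_pos]
    exact_mod_cast (by omega : p ≤ (p + 1) / 2 * 2)
  have hdR : (0 : ℝ) < d := by exact_mod_cast hd
  have hmR : (0 : ℝ) < m := by exact_mod_cast hm
  have hpR : (0 : ℝ) < p := by exact_mod_cast hp0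
  rw [le_div_iff₀ (by positivity)]
  calc 1 / (6 * (d : ℝ) * m) * (p : ℝ) ^ 2
      ≤ 1 / (4 * (d : ℝ) * m) * (p : ℝ) ^ 2 := by gcongr; norm_num
    _ = (p : ℝ) / (2 * d * m) * ((p : ℝ) / 2) := by field_simp; norm_num
    _ ≤ (p / (2 * d * m) + 1 : ℕ) * ((p + 1) / 2 : ℕ) := by gcongr
    _ ≤ _ := by exact_mod_cast hcard
end

section
/- Let p be a prime, m a positive integer with m ≤ p, a, b ∈ [p], and S ⊆ [p]. Then (1/2)·L(h_{a,b}, S) ≤ L(h_{a,0}, S) ≤ 2·L(h_{a,b}, S), where L(h, S) denotes the maximum bin size of S under h. -/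
/-- The size of the `i`-th bin: `B(h, S, i) = |S ∩ h⁻¹(i)|`. -/
def binSize (h : ℕ → ℕ) (S : Finset ℕ) (i : ℕ) : ℕ := (S.filter (fun x => h x = i)).card

/-- The maximum bin size `L(h, S) = max_{i ∈ [m]} B(h, S, i)`. -/
def maxBin (m : ℕ) (h : ℕ → ℕ) (S : Finset ℕ) : ℕ :=
  (Finset.range m).sup (fun i => binSize h S i)

/-- The elements of a bin for the shift `b` fall into at most two bins for the shift `c`. -/
theorem hab_eq_or_eq_of_hab_eq {p m a b c i x : ℕ} (hm : 0 < m) (hb : b < p)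
    (hx : hab p m a b x = i) :
    hab p m a c x = (i + (c + p - b) % p) % m ∨
      hab p m a c x = (i + (c + p - b) % p + (m * p - p)) % m := by
  have hshift : (a * x + c) % p = ((a * x + b) % p + (c + p - b) % p) % p := by
    rw [← Nat.add_mod, show a * x + b + (c + p - b) = a * x + c + p by omega, Nat.add_mod_right]
  have hp : 0 < p := by omega
  unfold hab at *
  rw [hshift]
  have hy := Nat.mod_lt (a * x + b) hp
  have hd := Nat.mod_lt (c + p - b) hp
  generalize (a * x + b) % p = y at *
  generalize (c + p - b) % p = d at *
  subst hx
  rcases lt_or_ge (y + d) p with h | h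
  · left
    rw [Nat.mod_eq_of_lt h, Nat.mod_add_mod]
  · right
    have hmp : p ≤ m * p := Nat.le_mul_of_pos_left p hm
    rw [Nat.mod_eq_sub_mod h, Nat.mod_eq_of_lt (show y + d - p < p by omega), add_assoc, Nat.mod_add_mod,
      show y + (d + (m * p - p)) = y + d - p + m * p by omega, Nat.add_mul_mod_self_left]

theorem binSize_le_maxBin {m i : ℕ} (h : ℕ → ℕ) (S : Finset ℕ) (hi : i < m) :
    binSize h S i ≤ maxBin m h S :=
  Finset.le_sup (f := fun i => binSize h S i) (Finset.mem_range.mpr hi)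

theorem maxBin_hab_le_two_mul {p m a b : ℕ} (c : ℕ) (hm : 0 < m) (hb : b < p) (S : Finset ℕ) :
    maxBin m (hab p m a b) S ≤ 2 * maxBin m (hab p m a c) S := by
  refine Finset.sup_le fun i _ => ?_
  set j := (i + (c + p - b) % p) % m
  set k := (i + (c + p - b) % p + (m * p - p)) % m
  calc binSize (hab p m a b) S i
      ≤ (S.filter (fun x => hab p m a c x = j) ∪ S.filter (fun x => hab p m a c x = k)).card := by
        refine Finset.card_le_card fun x hx => ?_
        rw [← Finset.filter_or]
        rw [Finset.mem_filter] at hx ⊢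
        exact ⟨hx.1, hab_eq_or_eq_of_hab_eq hm hb hx.2⟩
    _ ≤ binSize (hab p m a c) S j + binSize (hab p m a c) S k := Finset.card_union_le _ _
    _ ≤ maxBin m (hab p m a c) S + maxBin m (hab p m a c) S :=
        add_le_add (binSize_le_maxBin _ S (Nat.mod_lt _ hm)) (binSize_le_maxBin _ S (Nat.mod_lt _ hm))
    _ = 2 * maxBin m (hab p m a c) S := (two_mul _).symm

/-- **The shift `b` changes the maximum bin size by at most a factor of two:**
`(1/2)·L(h_{a,b}, S) ≤ L(h_{a,0}, S) ≤ 2·L(h_{a,b}, S)`. -/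
theorem maxBin_shift_factor_two
    (p m a b : ℕ) (hp : p.Prime) (hm : 0 < m) (hmp : m ≤ p)
    (ha : a < p) (hb : b < p) (S : Finset ℕ) (hS : S ⊆ Finset.range p) :
    maxBin m (hab p m a b) S ≤ 2 * maxBin m (hab p m a 0) S ∧
      maxBin m (hab p m a 0) S ≤ 2 * maxBin m (hab p m a b) S :=
  ⟨maxBin_hab_le_two_mul 0 hm hb S, maxBin_hab_le_two_mul b hm hp.pos S⟩
end

section
/- Let p be a prime, m a positive integer with m ≤ p, a ∈ [p], and S ⊆ [p] an arbitrary subset (possibly containing 0). Then L(h_{a,0}, S) − 1 ≤ L(h_{(p−a) mod p, 0}, S) ≤ L(h_{a,0}, S) + 1, where L(h, S) denotes the maximum bin size of S under h. -/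
/-- If `a + c = p` then, for `0 < x < p`, the residues of `c * x` and `a * x` add up to `p`. -/
theorem mul_mod_add_mul_mod_of_add_eq {p a c x : ℕ} (hp : p.Prime) (ha : 0 < a) (hc : 0 < c)
    (hac : a + c = p) (hx0 : x ≠ 0) (hxp : x < p) : (c * x) % p + (a * x) % p = p := by
  have hax : ¬ p ∣ a * x := by
    rw [hp.dvd_mul]
    rintro (h | h)
    · have := Nat.le_of_dvd ha h
      omega
    · have := Nat.le_of_dvd (Nat.pos_of_ne_zero hx0) h
      omega
  have hpos : 0 < (a * x) % p := Nat.pos_of_ne_zero fun h => hax (Nat.dvd_of_mod_eq_zero h)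
  have hdvd : p ∣ (c * x) % p + (a * x) % p := by
    rw [Nat.dvd_iff_mod_eq_zero, ← Nat.add_mod, ← Nat.add_mul, Nat.add_comm c a, hac,
      Nat.mul_mod_right]
  obtain ⟨k, hk⟩ := hdvd
  have h1 := Nat.mod_lt (c * x) hp.pos
  have h2 := Nat.mod_lt (a * x) hp.pos
  have hk0 : k ≠ 0 := by
    rintro rfl
    omega
  have hk2 : k < 2 := by
    by_contra! h
    have := Nat.mul_le_mul_left p h
    omega
  obtain rfl : k = 1 := by omega
  omega

/-- Replacing a nonzero multiplier by its negative raises the maximum bin size by at most one. -/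
theorem maxBin_le_maxBin_add_one_of_add_eq {p m a c : ℕ} (hp : p.Prime) (hm : 0 < m)
    (ha : 0 < a) (hc : 0 < c) (hac : a + c = p) {S : Finset ℕ} (hS : S ⊆ Finset.range p) :
    maxBin m (hab p m c 0) S ≤ maxBin m (hab p m a 0) S + 1 := by
  refine Finset.sup_le fun i _ => ?_
  have hsub : S.filter (fun x => hab p m c 0 x = i) ⊆
      insert 0 (S.filter (fun x => hab p m a 0 x = (p - i) % m)) := by
    intro x hx
    obtain ⟨hxS, hxi⟩ := Finset.mem_filter.1 hx
    rw [Finset.mem_insert, Finset.mem_filter]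
    refine or_iff_not_imp_left.2 fun hx0 => ⟨hxS, ?_⟩
    have hsum := mul_mod_add_mul_mod_of_add_eq hp ha hc hac hx0 (Finset.mem_range.1 (hS hxS))
    simp only [hab, Nat.add_zero] at hxi ⊢
    have hdiv := Nat.mod_add_div ((c * x) % p) m
    rw [hxi] at hdiv
    have hpi : p - i = (a * x) % p + m * ((c * x) % p / m) := by omega
    rw [hpi, Nat.add_mul_mod_self_left]
  calc binSize (hab p m c 0) S i
      ≤ binSize (hab p m a 0) S ((p - i) % m) + 1 :=
        (Finset.card_le_card hsub).trans (Finset.card_insert_le _ _)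
    _ ≤ maxBin m (hab p m a 0) S + 1 :=
        Nat.add_le_add_right (Finset.le_sup (f := fun j => binSize (hab p m a 0) S j)
          (Finset.mem_range.2 (Nat.mod_lt _ hm))) 1

/-- **Changing the sign of `a` changes the maximum bin size by at most one**, for an
arbitrary `S ⊆ [p]` (possibly containing `0`):
`L(h_{a,0}, S) − 1 ≤ L(h_{(p−a) mod p, 0}, S) ≤ L(h_{a,0}, S) + 1`. -/
theorem maxBin_neg_a_of_zero_mem
    (p m a : ℕ) (hp : p.Prime) (hm : 0 < m) (hmp : m ≤ p)
    (ha : a < p) (S : Finset ℕ) (hS : S ⊆ Finset.range p) :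
    maxBin m (hab p m a 0) S - 1 ≤ maxBin m (hab p m ((p - a) % p) 0) S ∧
      maxBin m (hab p m ((p - a) % p) 0) S ≤ maxBin m (hab p m a 0) S + 1 := by
  rcases Nat.eq_zero_or_pos a with rfl | ha0
  · simp
  · rw [Nat.mod_eq_of_lt (by omega : p - a < p)]
    have hc : 0 < p - a := by omega
    exact ⟨Nat.sub_le_of_le_add
        (maxBin_le_maxBin_add_one_of_add_eq hp hm hc ha0 (by omega) hS),
      maxBin_le_maxBin_add_one_of_add_eq hp hm ha0 hc (by omega) hS⟩
end

section
/- There is an absolute constant C > 0 such that for every positive integer m and every prime p with p ≥ m², the expected maximum bin size of the set S = [m] = {0, 1, ..., m−1} under a uniformly random simple linear hash function satisfies E[L(h, [m])] ≤ C, where the expectation is over the uniform choice of (a, b) ∈ [p]² and h = h_{a,b}. -/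
/-- Three points of a translate of the lattice `{(d, t) | p ∣ a * d - m * t}` that lie in a box of
area less than `p` are collinear. -/
theorem collinear_of_dvd {p m a c x₀ x x₁ y₀ y y₁ H : ℤ} (hp : Prime p) (hm : ¬ p ∣ m)
    (h₀ : p ∣ a * x₀ + c - m * y₀) (h : p ∣ a * x + c - m * y) (h₁ : p ∣ a * x₁ + c - m * y₁)
    (hx₀ : x₀ ≤ x) (hx₁ : x ≤ x₁) (hy₀ : 0 ≤ y₀) (hy : 0 ≤ y) (hy₁ : 0 ≤ y₁)
    (hH₀ : y₀ ≤ H) (hH : y ≤ H) (hH₁ : y₁ ≤ H) (harea : (x₁ - x₀) * H < p) :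
    (x - x₀) * (y₁ - y₀) = (x₁ - x₀) * (y - y₀) := by
  have hdvd : p ∣ m * ((x - x₀) * (y₁ - y₀) - (x₁ - x₀) * (y - y₀)) := by
    obtain ⟨u, hu⟩ := h₀
    obtain ⟨v, hv⟩ := h
    obtain ⟨w, hw⟩ := h₁
    refine ⟨(x₁ - x₀) * (v - u) - (x - x₀) * (w - u), ?_⟩
    linear_combination (x₁ - x₀) * (hv - hu) - (x - x₀) * (hw - hu)
  have hdet := (hp.dvd_or_dvd hdvd).resolve_left hm
  have habs : |(x - x₀) * (y₁ - y₀) - (x₁ - x₀) * (y - y₀)| < p := by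
    rw [abs_lt]
    constructor
    · nlinarith [mul_nonneg (sub_nonneg.2 hx₀) hy₁, mul_nonneg (sub_nonneg.2 hx₁) hy₀,
        mul_nonneg (sub_nonneg.2 (hx₀.trans hx₁)) (sub_nonneg.2 hH)]
    · nlinarith [mul_nonneg (sub_nonneg.2 hx₀) (sub_nonneg.2 hH₁),
        mul_nonneg (sub_nonneg.2 hx₁) (sub_nonneg.2 hH₀),
        mul_nonneg (sub_nonneg.2 (hx₀.trans hx₁)) hy]
  exact sub_eq_zero.1 (Int.eq_zero_of_abs_lt_dvd hdet habs)

/-- Among more than `n` integers, two have distance at most `1 / n` of the diameter. -/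
theorem exists_lt_mul_sub_le {P : Finset ℕ} {n x₀ x₁ : ℕ} (hn : 0 < n) (hcard : n < P.card)
    (hP : ∀ x ∈ P, x₀ ≤ x ∧ x ≤ x₁) :
    ∃ u ∈ P, ∃ v ∈ P, u < v ∧ n * (v - u) ≤ x₁ - x₀ := by
  obtain ⟨u, hu, v, hv, huv, heq⟩ := Finset.exists_ne_map_eq_of_card_lt_of_maps_to
    (t := Finset.range n) (f := fun x => n * (x - x₀) / (x₁ - x₀ + 1)) (by simpa using hcard) (by
      intro x hx
      have := hP x hx
      simp only [Finset.coe_range, Set.mem_Iio]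
      rw [Nat.div_lt_iff_lt_mul (by omega)]
      exact Nat.mul_lt_mul_of_pos_left (by omega) hn)
  have key : ∀ u ∈ P, ∀ v ∈ P, u < v →
      n * (u - x₀) / (x₁ - x₀ + 1) = n * (v - x₀) / (x₁ - x₀ + 1) →
      n * (v - u) ≤ x₁ - x₀ := by
    intro u hu v hv huv heq
    have hu' := hP u hu
    have h₁ := Nat.div_mul_le_self (n * (u - x₀)) (x₁ - x₀ + 1)
    have h₂ := Nat.lt_div_mul_add (a := n * (v - x₀)) (b := x₁ - x₀ + 1) (by omega)
    have h₃ : n * (v - x₀) = n * (v - u) + n * (u - x₀) := by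
      rw [← mul_add]
      congr 1
      omega
    rw [heq] at h₁
    omega
  rcases lt_or_gt_of_ne huv with h | h
  · exact ⟨u, hu, v, hv, h, key u hu v hv h heq⟩
  · exact ⟨v, hv, u, hu, h, key v hv u hu h heq.symm⟩

/-- A bin with more than `n` elements yields a short vector in the lattice
`{(d, t) | p ∣ a * d - m * t}`. -/
theorem exists_short_vector_of_lt_binSize {p m a b n i : ℕ} (hp : p.Prime) (hm : 0 < m)
    (hmp : m < p) (hn : 0 < n) (h : n < binSize (hab p m a b) (Finset.range m) i) :
    ∃ d : ℕ, ∃ t : ℤ, 0 < d ∧ n * d ≤ m ∧ (n * m : ℤ) * |t| ≤ p ∧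
      (p : ℤ) ∣ a * d - m * t := by
  unfold binSize at h
  set P := (Finset.range m).filter (fun x => hab p m a b x = i) with hPdef
  have hne : P.Nonempty := Finset.card_pos.1 (by omega)
  set x₀ := P.min' hne
  set x₁ := P.max' hne
  have hx₀P : x₀ ∈ P := P.min'_mem hne
  have hx₁P : x₁ ∈ P := P.max'_mem hne
  have hbd : ∀ x ∈ P, x₀ ≤ x ∧ x ≤ x₁ := fun x hx => ⟨P.min'_le x hx, P.le_max' x hx⟩
  obtain ⟨u, hu, v, hv, huv, hgap⟩ := exists_lt_mul_sub_le hn h hbd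
  have hx₁m : x₁ < m := by simpa using (Finset.mem_filter.1 hx₁P).1
  let y : ℕ → ℕ := fun x => ((a * x + b) % p) / m
  have hy : ∀ x ∈ P, (p : ℤ) ∣ a * x + (b - i) - m * y x := by
    intro x hx
    have h₁ : ((a * x + b) % p) % m = i := (Finset.mem_filter.1 hx).2
    have h₂ := Nat.mod_add_div ((a * x + b) % p) m
    have h₃ := Nat.mod_add_div (a * x + b) p
    rw [h₁] at h₂
    refine ⟨((a * x + b) / p : ℕ), ?_⟩
    have h₂' : (i : ℤ) + m * y x = ((a * x + b) % p : ℕ) := by exact_mod_cast h₂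
    have h₃' : (((a * x + b) % p : ℕ) : ℤ) + p * ((a * x + b) / p : ℕ) = a * x + b := by
      exact_mod_cast h₃
    linear_combination -h₂' - h₃'
  have hyH : ∀ x, y x ≤ (p - 1) / m := fun x => Nat.div_le_div_right (by
    have := Nat.mod_lt (a * x + b) hp.pos
    omega)
  have hmH : m * ((p - 1) / m) ≤ p - 1 := Nat.mul_div_le _ _
  have hpm : ¬ (p : ℤ) ∣ m := by
    rw [Int.natCast_dvd_natCast]
    exact Nat.not_dvd_of_pos_of_lt hm hmp
  generalize (p - 1) / m = H at hyH hmH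
  have hmH' : (m : ℤ) * H < p := by
    have := hp.pos
    exact_mod_cast (by omega : m * H < p)
  have hcol : ∀ x ∈ P, ((x : ℤ) - x₀) * (y x₁ - y x₀) = (x₁ - x₀) * (y x - y x₀) := by
    intro x hx
    refine collinear_of_dvd (Nat.prime_iff_prime_int.1 hp) hpm (hy _ hx₀P) (hy _ hx) (hy _ hx₁P)
      (by exact_mod_cast (hbd x hx).1) (by exact_mod_cast (hbd x hx).2) (by positivity)
      (by positivity) (by positivity) (H := H) (by exact_mod_cast hyH _) (by exact_mod_cast hyH _)
      (by exact_mod_cast hyH _) (lt_of_le_of_lt ?_ hmH')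
    have : (x₁ : ℤ) - x₀ ≤ m := by omega
    gcongr
  have hu' := hbd u hu
  have hv' := hbd v hv
  have hcast : ((v - u : ℕ) : ℤ) = (v : ℤ) - u := by push_cast [huv.le]; ring
  refine ⟨v - u, (y v : ℤ) - y u, by omega, by omega, ?_, ?_⟩
  · have hD : (0 : ℤ) < (x₁ : ℤ) - x₀ := by omega
    have hline : ((v : ℤ) - u) * (y x₁ - y x₀) = (x₁ - x₀) * (y v - y u) := by
      linear_combination hcol v hv - hcol u hu
    have hgap' : (n : ℤ) * (v - u) ≤ x₁ - x₀ := by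
      have : ((n * (v - u) : ℕ) : ℤ) ≤ (x₁ - x₀ : ℕ) := by exact_mod_cast hgap
      rw [Nat.cast_mul, hcast] at this
      omega
    have hT : |(y x₁ : ℤ) - y x₀| ≤ H := by
      have h₀ := hyH x₀
      have h₁ := hyH x₁
      rw [abs_le]
      constructor <;> omega
    have habs : ((v : ℤ) - u) * |(y x₁ : ℤ) - y x₀| = (x₁ - x₀) * |(y v : ℤ) - y u| := by
      have := congrArg abs hline
      rwa [abs_mul, abs_mul, abs_of_pos hD, abs_of_pos (by omega : (0 : ℤ) < (v : ℤ) - u)] at this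
    have hnt : (n : ℤ) * |(y v : ℤ) - y u| ≤ H := by
      refine le_trans (le_of_mul_le_mul_left ?_ hD) hT
      calc ((x₁ : ℤ) - x₀) * (n * |(y v : ℤ) - y u|)
          = (n * (v - u)) * |(y x₁ : ℤ) - y x₀| := by linear_combination -(n : ℤ) * habs
        _ ≤ _ := by gcongr
    calc (n * m : ℤ) * |(y v : ℤ) - y u| = m * (n * |(y v : ℤ) - y u|) := by ring
      _ ≤ m * H := by gcongr
      _ ≤ p := hmH'.le
  · have := dvd_sub (hy v hv) (hy u hu)
    rw [hcast]
    rwa [show (a * v + (b - i) - m * y v - (a * u + (b - i) - m * y u) : ℤ) =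
      a * (v - u) - m * (y v - y u) by ring] at this

open Classical in
/-- The tail bound for a random multiplier, uniformly in the shift `b`. -/
theorem card_filter_lt_maxBin_le {p m n : ℕ} (hp : p.Prime) (hm : 0 < m) (hmp : m < p)
    (hn : 0 < n) :
    ((Finset.range p).filter (fun a => ∃ b, n < maxBin m (hab p m a b) (Finset.range m))).card ≤
      (m / n) * (2 * (p / (n * m)) + 1) := by
  set K := p / (n * m)
  let D := Finset.Icc 1 (m / n) ×ˢ Finset.Icc (-(K : ℤ)) K
  have hsub : (Finset.range p).filter
      (fun a => ∃ b, n < maxBin m (hab p m a b) (Finset.range m)) ⊆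
      D.biUnion (fun q => (Finset.range p).filter (fun a : ℕ => (p : ℤ) ∣ a * q.1 - m * q.2)) := by
    intro a ha
    obtain ⟨hap, b, hb⟩ := Finset.mem_filter.1 ha
    obtain ⟨i, -, hi⟩ := Finset.lt_sup_iff.1 hb
    obtain ⟨d, t, hd, hnd, hnt, hdvd⟩ := exists_short_vector_of_lt_binSize hp hm hmp hn hi
    refine Finset.mem_biUnion.2 ⟨(d, t), ?_, Finset.mem_filter.2 ⟨hap, hdvd⟩⟩
    have ht : |t| ≤ K := by
      rw [Int.natCast_div, Int.le_ediv_iff_mul_le (by positivity)]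
      push_cast
      linarith
    simp only [D, Finset.mem_product, Finset.mem_Icc]
    refine ⟨⟨hd, ?_⟩, abs_le.1 ht⟩
    rw [Nat.le_div_iff_mul_le hn]
    linarith
  have hone : ∀ q ∈ D,
      ((Finset.range p).filter (fun a : ℕ => (p : ℤ) ∣ a * q.1 - m * q.2)).card ≤ 1 := by
    intro q hq
    simp only [D, Finset.mem_product, Finset.mem_Icc] at hq
    have hqm := hq.1.2.trans (Nat.div_le_self m n)
    rw [Finset.card_le_one]
    intro a ha a' ha'
    simp only [Finset.mem_filter, Finset.mem_range] at ha ha'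
    have hdvd : (p : ℤ) ∣ ((a : ℤ) - a') * q.1 := by
      have := dvd_sub ha.2 ha'.2
      rwa [show (a * q.1 - m * q.2 - (a' * q.1 - m * q.2) : ℤ) = (a - a') * q.1 by ring] at this
    have hq1 : ¬ (p : ℤ) ∣ q.1 := by
      rw [Int.natCast_dvd_natCast]
      exact Nat.not_dvd_of_pos_of_lt hq.1.1 (by omega)
    have h₁ := ((Nat.prime_iff_prime_int.1 hp).dvd_or_dvd hdvd).resolve_right hq1
    have h₂ := Int.eq_zero_of_abs_lt_dvd h₁ (by rw [abs_lt]; constructor <;> omega)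
    omega
  calc _ ≤ _ := Finset.card_le_card hsub
    _ ≤ D.card * 1 := Finset.card_biUnion_le_card_mul _ _ _ hone
    _ = _ := by
      rw [mul_one, Finset.card_product, Nat.card_Icc, Int.card_Icc, Nat.add_sub_cancel]
      congr 1
      omega

theorem sum_Icc_inv_sq_le_two (m : ℕ) : ∑ n ∈ Finset.Icc 1 m, ((n : ℝ) ^ 2)⁻¹ ≤ 2 := by
  have h : ∀ k : ℕ, ∑ n ∈ Finset.Icc 1 (k + 1), ((n : ℝ) ^ 2)⁻¹ ≤ 2 - ((k : ℝ) + 1)⁻¹ := by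
    intro k
    induction k with
    | zero => norm_num
    | succ k ih =>
      rw [Finset.sum_Icc_succ_top (by omega)]
      have : (((k : ℝ) + 1 + 1) ^ 2)⁻¹ ≤ ((k : ℝ) + 1)⁻¹ - ((k : ℝ) + 1 + 1)⁻¹ := by
        rw [inv_sub_inv (by positivity) (by positivity), inv_eq_one_div]
        rw [div_le_div_iff₀ (by positivity) (by positivity)]
        have : (0 : ℝ) ≤ k := by positivity
        nlinarith
      push_cast
      linarith
  rcases m with _ | k
  · simp
  · have : (0 : ℝ) ≤ ((k : ℝ) + 1)⁻¹ := by positivity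
    linarith [h k]

theorem maxBin_range_le (m : ℕ) (h : ℕ → ℕ) : maxBin m h (Finset.range m) ≤ m :=
  Finset.sup_le fun _ _ => (Finset.card_filter_le _ _).trans (Finset.card_range m).le

theorem le_one_add_sum_indicator {L m : ℕ} (h : L ≤ m) :
    (L : ℝ) ≤ 1 + ∑ n ∈ Finset.Icc 1 m, if n < L then (1 : ℝ) else 0 := by
  rw [Finset.sum_boole]
  have hsub : Finset.Ico 1 L ⊆ (Finset.Icc 1 m).filter (fun n => n < L) := by
    intro n hn
    simp only [Finset.mem_Ico, Finset.mem_filter, Finset.mem_Icc] at hn ⊢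
    omega
  have := Finset.card_le_card hsub
  rw [Nat.card_Ico] at this
  exact_mod_cast (by omega : L ≤ 1 + ((Finset.Icc 1 m).filter (fun n => n < L)).card)

theorem sum_indicator_lt_maxBin_le {p m n : ℕ} (hp : p.Prime) (hm : 0 < m) (hmp : m < p)
    (hsq : m ^ 2 ≤ p) (hn : 0 < n) (hnm : n ≤ m) :
    ∑ ab ∈ Finset.range p ×ˢ Finset.range p,
      (if n < maxBin m (hab p m ab.1 ab.2) (Finset.range m) then (1 : ℝ) else 0) ≤
      3 * (p : ℝ) ^ 2 * ((n : ℝ) ^ 2)⁻¹ := by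
  classical
  have hcard : ((Finset.range p ×ˢ Finset.range p).filter
      (fun ab => n < maxBin m (hab p m ab.1 ab.2) (Finset.range m))).card ≤
      (m / n) * (2 * (p / (n * m)) + 1) * p := by
    refine le_trans (Finset.card_le_card (t := (Finset.range p).filter
      (fun a => ∃ b, n < maxBin m (hab p m a b) (Finset.range m)) ×ˢ Finset.range p) ?_) ?_
    · intro ab h_ab
      simp only [Finset.mem_filter, Finset.mem_product] at h_ab ⊢
      exact ⟨⟨h_ab.1.1, ab.2, h_ab.2⟩, h_ab.1.2⟩
    · rw [Finset.card_product, Finset.card_range]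
      exact Nat.mul_le_mul_right _ (card_filter_lt_maxBin_le hp hm hmp hn)
  rw [Finset.sum_boole]
  have hn' : (0 : ℝ) < n := by exact_mod_cast hn
  have hm' : (0 : ℝ) < m := by exact_mod_cast hm
  have hmn : (m : ℝ) * n ≤ p := by
    exact_mod_cast (Nat.mul_le_mul_left m hnm).trans (by rwa [← sq])
  have h₁ : ((m / n : ℕ) : ℝ) ≤ m / n := Nat.cast_div_le
  have h₂ : ((p / (n * m) : ℕ) : ℝ) ≤ p / (n * m) := by
    exact_mod_cast (Nat.cast_div_le (α := ℝ) (m := p) (n := n * m))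
  calc _ ≤ (((m / n) * (2 * (p / (n * m)) + 1) * p : ℕ) : ℝ) := by exact_mod_cast hcard
    _ = (m / n : ℕ) * (2 * (p / (n * m) : ℕ) + 1) * p := by push_cast; ring
    _ ≤ (m / n) * (2 * (p / (n * m)) + 1) * p := by gcongr
    _ = (2 * p + m * n) * p * ((n : ℝ) ^ 2)⁻¹ := by field_simp
    _ ≤ (2 * p + p) * p * ((n : ℝ) ^ 2)⁻¹ := by gcongr
    _ = _ := by ring

/-- **Main theorem: the expected maximum load on the interval `[m]` is constant.**
There is an absolute constant `C > 0` such that for every positive integer `m` and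
every prime `p ≥ m²`, the expectation over a uniform pair `(a, b) ∈ [p]²` of the
maximum bin size of `[m]` under `h_{a,b}` is at most `C`. -/
theorem expected_maxBin_interval_constant :
    ∃ C : ℝ, 0 < C ∧ ∀ p m : ℕ, p.Prime → 0 < m → m ^ 2 ≤ p →
      (∑ ab ∈ (Finset.range p) ×ˢ (Finset.range p),
          (maxBin m (hab p m ab.1 ab.2) (Finset.range m) : ℝ)) / (p : ℝ) ^ 2 ≤ C := by
  refine ⟨7, by norm_num, fun p m hp hm hsq => ?_⟩
  have hmp : m < p := by
    have := hp.two_le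
    nlinarith
  have hp' : (0 : ℝ) < p := by exact_mod_cast hp.pos
  rw [div_le_iff₀ (by positivity)]
  calc _ ≤ ∑ ab ∈ Finset.range p ×ˢ Finset.range p, (1 + ∑ n ∈ Finset.Icc 1 m,
        if n < maxBin m (hab p m ab.1 ab.2) (Finset.range m) then (1 : ℝ) else 0) :=
        Finset.sum_le_sum fun ab _ => le_one_add_sum_indicator (maxBin_range_le m _)
    _ = (p : ℝ) ^ 2 + ∑ n ∈ Finset.Icc 1 m, ∑ ab ∈ Finset.range p ×ˢ Finset.range p,
        if n < maxBin m (hab p m ab.1 ab.2) (Finset.range m) then (1 : ℝ) else 0 := by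
        rw [Finset.sum_add_distrib, Finset.sum_comm]
        simp [sq]
    _ ≤ (p : ℝ) ^ 2 + ∑ n ∈ Finset.Icc 1 m, 3 * (p : ℝ) ^ 2 * ((n : ℝ) ^ 2)⁻¹ := by
        gcongr with n hn
        have := Finset.mem_Icc.1 hn
        exact sum_indicator_lt_maxBin_le hp hm hmp hsq this.1 this.2
    _ ≤ (p : ℝ) ^ 2 + 3 * (p : ℝ) ^ 2 * 2 := by
        rw [← Finset.mul_sum]
        gcongr
        exact sum_Icc_inv_sq_le_two m
    _ = 7 * (p : ℝ) ^ 2 := by ring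
end

section
/- There is an absolute constant C > 0 such that for every positive integer m, every prime p with p ≥ m², and every integer l with l ≥ 3, the probability over a uniformly random pair (a, b) ∈ [p]² that the maximum bin size of [m] = {0, 1, ..., m−1} under h_{a,b} is at least l satisfies P[L(h_{a,b}, [m]) ≥ l] ≤ C/l². -/
/-- A finite set of more than `n` naturals contains two distinct elements whose distance is at
most an `n`-th of the diameter of the set. -/
lemma exists_close_pair (S : Finset ℕ) {n : ℕ} (hn : 0 < n) (h : n < S.card) :
    ∃ x ∈ S, ∃ y ∈ S, ∃ u ∈ S, ∃ v ∈ S, u < v ∧ (∀ w ∈ S, x ≤ w ∧ w ≤ y) ∧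
      ((v : ℤ) - u) * n ≤ (y : ℤ) - x := by
  have hne : S.Nonempty := Finset.card_pos.mp (by omega)
  have hmin : ∀ w ∈ S, S.min' hne ≤ w := fun w hw => S.min'_le w hw
  have hmax : ∀ w ∈ S, w ≤ S.max' hne := fun w hw => S.le_max' w hw
  have hx := S.min'_mem hne
  have hy := S.max'_mem hne
  generalize S.min' hne = x at *
  generalize S.max' hne = y at *
  have hmaps : ∀ w ∈ S, (w - x) * n / (y - x + 1) ∈ Finset.range n := by
    intro w hw
    rw [Finset.mem_range, Nat.div_lt_iff_lt_mul (by omega), mul_comm n]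
    have := hmax w hw
    exact Nat.mul_lt_mul_of_pos_right (by omega) hn
  obtain ⟨u, hu, v, hv, huv, heq⟩ :=
    Finset.exists_ne_map_eq_of_card_lt_of_maps_to (by simpa using h) hmaps
  wlog hlt : u < v generalizing u v
  · exact this v hv u hu huv.symm heq.symm (by omega)
  refine ⟨x, hx, y, hy, u, hu, v, hv, hlt, fun w hw => ⟨hmin w hw, hmax w hw⟩, ?_⟩
  have h1 := Nat.div_mul_le_self ((u - x) * n) (y - x + 1)
  have h2 := Nat.lt_div_mul_add (a := (v - x) * n) (b := y - x + 1) (by omega)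
  rw [heq] at h1
  have h3 : (v - x) * n < (u - x) * n + (y - x + 1) := by omega
  have hxu := hmin u hu
  have hxv := hmin v hv
  have hxy := hmin y hy
  zify [hxu, hxv, hxy] at h3
  linarith

/-- Points of the lattice `{(x, k) : m k ≡ a x + b mod p}` in a box of width less than `m` and
height less than `p / m` are collinear. -/
lemma lattice_collinear {p m a b : ℤ} (hp : Prime p) (hm : 0 < m) (hmp : m < p)
    {x y z kx ky kz : ℤ} (hxy : x ≤ y) (hyz : y ≤ z) (hzx : z - x < m)
    (hx : p ∣ a * x + b - m * kx) (hy : p ∣ a * y + b - m * ky) (hz : p ∣ a * z + b - m * kz)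
    (hkxy : m * |ky - kx| < p) (hkyz : m * |kz - ky| < p) :
    (z - x) * (ky - kx) = (y - x) * (kz - kx) := by
  have hdvd : p ∣ m * ((y - x) * (kz - ky) - (z - y) * (ky - kx)) := by
    have : m * ((y - x) * (kz - ky) - (z - y) * (ky - kx)) =
        (y - x) * ((a * y + b - m * ky) - (a * z + b - m * kz)) -
        (z - y) * ((a * x + b - m * kx) - (a * y + b - m * ky)) := by ring
    rw [this]
    exact dvd_sub (Dvd.dvd.mul_left (dvd_sub hy hz) _) (Dvd.dvd.mul_left (dvd_sub hx hy) _)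
  have hpm : ¬ p ∣ m := fun h => absurd (Int.le_of_dvd hm h) (by omega)
  have hdvd' := (hp.dvd_or_dvd hdvd).resolve_left hpm
  have habs : |(y - x) * (kz - ky) - (z - y) * (ky - kx)| < p := by
    have h1 := abs_sub ((y - x) * (kz - ky)) ((z - y) * (ky - kx))
    rw [abs_mul (y - x), abs_mul (z - y), abs_of_nonneg (sub_nonneg.mpr hxy),
      abs_of_nonneg (sub_nonneg.mpr hyz)] at h1
    refine lt_of_mul_lt_mul_left (a := m) ?_ hm.le
    have h2 := mul_le_mul_of_nonneg_left hkyz.le (sub_nonneg.mpr hxy)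
    have h3 := mul_le_mul_of_nonneg_left hkxy.le (sub_nonneg.mpr hyz)
    have h4 := mul_le_mul_of_nonneg_left h1 hm.le
    have h5 := mul_lt_mul_of_pos_right hzx (hm.trans hmp)
    linarith
  linarith [Int.eq_zero_of_abs_lt_dvd hdvd' habs]

/-- A bin with more than `n` elements forces a short vector in the lattice
`{(d, t) : a d ≡ m t mod p}`. -/
lemma exists_short_vector {p m a b n i : ℕ} (hp : p.Prime) (hm : 0 < m) (hmp : m < p)
    (hn : 0 < n) (h : n < binSize (hab p m a b) (Finset.range m) i) :
    ∃ dt ∈ Finset.Icc 1 (m / n) ×ˢ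
        Finset.Icc (-((p / (m * n) : ℕ) : ℤ)) ((p / (m * n) : ℕ) : ℤ),
      (p : ℤ) ∣ a * (dt.1 : ℤ) - m * dt.2 := by
  obtain ⟨x, hx, y, hy, u, hu, v, hv, huv, hS, hclose⟩ := exists_close_pair _ hn h
  set k : ℕ → ℤ := fun w => (((a * w + b) % p / m : ℕ) : ℤ) with hk
  have hmem : ∀ w ∈ (Finset.range m).filter (fun x => hab p m a b x = i),
      w < m ∧ (p : ℤ) ∣ a * w + (b - i) - m * k w ∧ 0 ≤ m * k w ∧ m * k w < p := by
    intro w hw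
    rw [Finset.mem_filter, Finset.mem_range] at hw
    obtain ⟨hwm, hwi⟩ := hw
    unfold hab at hwi
    have h1 := Nat.div_add_mod ((a * w + b) % p) m
    have h2 := Nat.div_add_mod (a * w + b) p
    have h3 := Nat.mod_lt (a * w + b) hp.pos
    rw [hwi] at h1
    refine ⟨hwm, ⟨((a * w + b) / p : ℕ), ?_⟩, by positivity, ?_⟩
    · rw [← h1] at h2
      have h4 : (p : ℤ) * ((a * w + b) / p : ℕ) + (m * ((a * w + b) % p / m : ℕ) + i) =
        a * w + b := by exact_mod_cast h2
      simp only [hk]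
      linarith
    · simp only [hk]
      have : m * ((a * w + b) % p / m) < p := by omega
      exact_mod_cast this
  have hdiff : ∀ w ∈ (Finset.range m).filter (fun x => hab p m a b x = i),
      ∀ w' ∈ (Finset.range m).filter (fun x => hab p m a b x = i),
      (m : ℤ) * |k w - k w'| < p := by
    intro w hw w' hw'
    obtain ⟨-, -, h1, h2⟩ := hmem w hw
    obtain ⟨-, -, h3, h4⟩ := hmem w' hw'
    rw [← abs_of_pos (show (0 : ℤ) < m by exact_mod_cast hm), ← abs_mul, abs_lt]
    constructor <;> linarith
  have hym := (hmem y hy).1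
  have hcol : ∀ w ∈ (Finset.range m).filter (fun x => hab p m a b x = i),
      ((y : ℤ) - x) * (k w - k x) = (w - x) * (k y - k x) := by
    intro w hw
    refine lattice_collinear (Nat.prime_iff_prime_int.mp hp) (by exact_mod_cast hm)
      (by exact_mod_cast hmp) (by exact_mod_cast (hS w hw).1) (by exact_mod_cast (hS w hw).2)
      (by omega) (hmem x hx).2.1 (hmem w hw).2.1 (hmem y hy).2.1 (hdiff w hw x hx)
      (hdiff y hy w hw)
  have hpar : ((y : ℤ) - x) * (k v - k u) = (v - u) * (k y - k x) := by
    linarith [hcol u hu, hcol v hv]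
  have hux := hS u hu
  have hvx := hS v hv
  have hD : (0 : ℤ) < (y : ℤ) - x := by omega
  have hd : (0 : ℤ) < (v : ℤ) - u := by omega
  have ht : |k v - k u| * n ≤ |k y - k x| := by
    have habs := congrArg abs hpar
    rw [abs_mul, abs_mul, abs_of_pos hD, abs_of_pos hd] at habs
    refine le_of_mul_le_mul_left (a := (y : ℤ) - x) ?_ hD
    have := mul_le_mul_of_nonneg_right hclose (abs_nonneg (k y - k x))
    calc ((y : ℤ) - x) * (|k v - k u| * n) = (v - u) * n * |k y - k x| := by
          rw [← mul_assoc, habs]; ring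
      _ ≤ _ := this
  have htm : |k v - k u| ≤ ((p / (m * n) : ℕ) : ℤ) := by
    rw [Int.natCast_ediv, Int.le_ediv_iff_mul_le (by exact_mod_cast Nat.mul_pos hm hn)]
    have := mul_le_mul_of_nonneg_left ht (Int.natCast_nonneg m)
    push_cast
    linarith [hdiff y hy x hx]
  refine ⟨(v - u, k v - k u), ?_, ?_⟩
  · rw [Finset.mem_product, Finset.mem_Icc, Finset.mem_Icc]
    refine ⟨⟨by simp only; omega, ?_⟩, abs_le.mp htm⟩
    rw [Nat.le_div_iff_mul_le hn]
    zify [huv.le]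
    omega
  · have := dvd_sub (hmem v hv).2.1 (hmem u hu).2.1
    rw [Nat.cast_sub huv.le]
    refine (congrArg ((p : ℤ) ∣ ·) ?_).mp this
    ring

/-- The number of multipliers `a` for which some shift `b` yields a maximum bin size above `n`
is at most `3 p / n²`. -/
lemma card_filter_maxBin_mul_sq_le {p m n : ℕ} (hp : p.Prime) (hm : 0 < m) (hmp : m ^ 2 ≤ p)
    (hn : 0 < n) :
    ((Finset.range p).filter (fun a =>
      ∃ b ∈ Finset.range p, n < maxBin m (hab p m a b) (Finset.range m))).card * n ^ 2 ≤ 3 * p := by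
  have hlt : m < p := by
    have := hp.two_le
    nlinarith
  have hcard : ((Finset.range p).filter (fun a =>
      ∃ b ∈ Finset.range p, n < maxBin m (hab p m a b) (Finset.range m))).card ≤
      (Finset.Icc 1 (m / n) ×ˢ
        Finset.Icc (-((p / (m * n) : ℕ) : ℤ)) ((p / (m * n) : ℕ) : ℤ)).card := by
    refine Finset.card_le_card_of_forall_subsingleton
      (fun (a : ℕ) (dt : ℕ × ℤ) => (p : ℤ) ∣ a * (dt.1 : ℤ) - m * dt.2) ?_ ?_
    · intro a ha
      obtain ⟨b, -, hb⟩ := (Finset.mem_filter.mp ha).2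
      obtain ⟨i, -, hi⟩ := Finset.lt_sup_iff.mp hb
      exact exists_short_vector hp hm hlt hn hi
    · rintro ⟨d, t⟩ hdt a ⟨ha, had⟩ a' ⟨ha', had'⟩
      have ha := Finset.mem_range.mp (Finset.mem_filter.mp ha).1
      have ha' := Finset.mem_range.mp (Finset.mem_filter.mp ha').1
      have hd := Finset.mem_Icc.mp (Finset.mem_product.mp hdt).1
      have hdm : d < p := (hd.2.trans (Nat.div_le_self m n)).trans_lt hlt
      have hdvd : (p : ℤ) ∣ ((a : ℤ) - a') * d := by
        have := dvd_sub had had'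
        rwa [sub_sub_sub_cancel_right, ← sub_mul] at this
      have hpd : ¬ (p : ℤ) ∣ d := fun h =>
        absurd (Nat.le_of_dvd hd.1 (by exact_mod_cast h)) (by omega)
      have := ((Nat.prime_iff_prime_int.mp hp).dvd_or_dvd hdvd).resolve_right hpd
      have := Int.eq_zero_of_abs_lt_dvd this (by rw [abs_lt]; omega)
      omega
  refine (Nat.mul_le_mul_right _ hcard).trans ?_
  rw [Finset.card_product, Nat.card_Icc, Int.card_Icc, Nat.add_sub_cancel]
  have hT : (((p / (m * n) : ℕ) : ℤ) + 1 - -((p / (m * n) : ℕ) : ℤ)).toNat =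
      2 * (p / (m * n)) + 1 := by omega
  rw [hT]
  rcases Nat.lt_or_ge m n with hmn | hnm
  · simp [Nat.div_eq_of_lt hmn]
  have hT1 : 1 ≤ p / (m * n) := by
    rw [Nat.le_div_iff_mul_le (by positivity)]
    nlinarith
  have hDn := Nat.div_mul_le_self m n
  have hTn := Nat.div_mul_le_self p (m * n)
  generalize m / n = D at *
  generalize p / (m * n) = T at *
  have hDT : D * T * n ^ 2 ≤ p := by
    refine Nat.le_of_mul_le_mul_left ?_ hm
    calc m * (D * T * n ^ 2) = (D * n) * (T * (m * n)) := by ring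
      _ ≤ m * p := Nat.mul_le_mul hDn hTn
  calc D * (2 * T + 1) * n ^ 2 ≤ D * (3 * T) * n ^ 2 := by gcongr; omega
    _ = 3 * (D * T * n ^ 2) := by ring
    _ ≤ 3 * p := by gcongr

/-- **Tail bound for the maximum load on the interval `[m]`.**  There is an absolute
constant `C > 0` such that for every positive integer `m`, every prime `p ≥ m²` and
every integer `l ≥ 3`, the probability over a uniform pair `(a, b) ∈ [p]²` that the
maximum bin size of `[m]` under `h_{a,b}` is at least `l` is at most `C/l²`. -/
theorem maxBin_interval_tail_bound :
    ∃ C : ℝ, 0 < C ∧ ∀ p m l : ℕ, p.Prime → 0 < m → m ^ 2 ≤ p → 3 ≤ l →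
      ((((Finset.range p) ×ˢ (Finset.range p)).filter (fun ab =>
          l ≤ maxBin m (hab p m ab.1 ab.2) (Finset.range m))).card : ℝ) / (p : ℝ) ^ 2 ≤
        C / (l : ℝ) ^ 2 := by
  refine ⟨12, by norm_num, fun p m l hp hm hmp hl => ?_⟩
  obtain ⟨n, rfl⟩ : ∃ n, l = n + 1 := ⟨l - 1, by omega⟩
  have hbad := card_filter_maxBin_mul_sq_le hp hm hmp (n := n) (by omega)
  have hsub : ((Finset.range p) ×ˢ (Finset.range p)).filter (fun ab =>
      n + 1 ≤ maxBin m (hab p m ab.1 ab.2) (Finset.range m)) ⊆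
      ((Finset.range p).filter (fun a =>
        ∃ b ∈ Finset.range p, n < maxBin m (hab p m a b) (Finset.range m))) ×ˢ Finset.range p := by
    rintro ⟨a, b⟩ h
    rw [Finset.mem_filter, Finset.mem_product] at h
    exact Finset.mem_product.mpr ⟨Finset.mem_filter.mpr ⟨h.1.1, b, h.1.2, h.2⟩, h.1.2⟩
  have hcard := Finset.card_le_card hsub
  rw [Finset.card_product, Finset.card_range] at hcard
  have hpos : (0 : ℝ) < p := by exact_mod_cast hp.pos
  rw [div_le_div_iff₀ (by positivity) (by positivity)]
  norm_cast
  generalize ((Finset.range p).filter (fun a =>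
    ∃ b ∈ Finset.range p, n < maxBin m (hab p m a b) (Finset.range m))).card = A at *
  calc _ ≤ A * p * (2 * n) ^ 2 := Nat.mul_le_mul hcard (Nat.pow_le_pow_left (by omega) 2)
    _ = 4 * p * (A * n ^ 2) := by ring
    _ ≤ 4 * p * (3 * p) := by gcongr
    _ = 12 * p ^ 2 := by ring
end

section
/- There is an absolute constant C > 0 such that the following holds. Let m be a positive integer, p a prime with p ≥ m², and let α, β ∈ [p] with α ≠ 0. Let S = {(α·x + β) mod p : x ∈ [m]} be the image of the interval [m] = {0, ..., m−1} under the linear map x ↦ (α·x + β) mod p (so |S| = m). Then the expected maximum bin size of S under a uniformly random simple linear hash function satisfies E[L(h, S)] ≤ C, where the expectation is over the uniform choice of (a, b) ∈ [p]² and h = h_{a,b}. -/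
/-- A finite set of at least two naturals contains two elements whose gap is at most the
average gap. -/
theorem exists_small_gap {X : Finset ℕ} {s lo hi : ℕ} (hs : 1 ≤ s) (hX : s + 1 ≤ X.card)
    (hlo : ∀ x ∈ X, lo ≤ x) (hhi : ∀ x ∈ X, x ≤ hi) :
    ∃ x ∈ X, ∃ y ∈ X, x < y ∧ (y - x) * s ≤ hi - lo := by
  classical
  have hne : ((X ×ˢ X).filter fun q => q.1 < q.2).Nonempty := by
    obtain ⟨u, hu, v, hv, huv⟩ := Finset.one_lt_card.mp (show 1 < X.card by omega)
    rcases lt_or_gt_of_ne huv with h | h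
    · exact ⟨(u, v), by simp [hu, hv, h]⟩
    · exact ⟨(v, u), by simp [hu, hv, h]⟩
  obtain ⟨⟨x, y⟩, hxy, hmin⟩ := Finset.exists_min_image _ (fun q => q.2 - q.1) hne
  simp only [Finset.mem_filter, Finset.mem_product] at hxy hmin
  obtain ⟨⟨hx, hy⟩, hlt⟩ := hxy
  refine ⟨x, hx, y, hy, hlt, ?_⟩
  have hd : 0 < y - x := by omega
  have hlt_of_lt : ∀ u ∈ X, ∀ v ∈ X, u < v → (u - lo) / (y - x) < (v - lo) / (y - x) := by
    intro u hu v hv huv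
    have h := hmin (u, v) ⟨⟨hu, hv⟩, huv⟩
    have := hlo u hu
    calc (u - lo) / (y - x) < (u - lo) / (y - x) + 1 := Nat.lt_succ_self _
      _ = (u - lo + (y - x)) / (y - x) := (Nat.add_div_right _ hd).symm
      _ ≤ (v - lo) / (y - x) := Nat.div_le_div_right (by simp only at h; omega)
  have hcard : X.card ≤ (Finset.range ((hi - lo) / (y - x) + 1)).card := by
    refine Finset.card_le_card_of_injOn (fun u => (u - lo) / (y - x)) ?_ ?_
    · intro u hu
      have := Nat.div_le_div_right (c := y - x) (Nat.sub_le_sub_right (hhi u hu) lo)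
      simp only [Finset.coe_range, Set.mem_Iio]
      omega
    · intro u hu v hv huv
      rcases lt_trichotomy u v with h | h | h
      · exact absurd huv (hlt_of_lt u hu v hv h).ne
      · exact h
      · exact absurd huv (hlt_of_lt v hv u hu h).ne'
  rw [Finset.card_range] at hcard
  rw [mul_comm]
  exact (Nat.le_div_iff_mul_le hd).mp (by omega)

/-- Three points of a lattice of determinant `p` that lie in a box of area less than `p` are
collinear. -/
theorem collinear_of_lattice_box {p m A w u y₀ y₁ y : ℤ} (hcop : IsCoprime p m)
    (hp : 0 < p) (hm : 0 < m) (hu : 0 ≤ u) (huw : u ≤ w) (hwm : w < m)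
    (h₀ : 0 ≤ y₀) (h₁ : 0 ≤ y₁) (h : 0 ≤ y) (h₀p : m * y₀ < p) (h₁p : m * y₁ < p)
    (hyp : m * y < p) (hw : p ∣ A * w - m * (y₁ - y₀)) (hu' : p ∣ A * u - m * (y - y₀)) :
    u * (y₁ - y₀) = w * (y - y₀) := by
  have hdvd : p ∣ u * (y₁ - y₀) - w * (y - y₀) := by
    refine hcop.dvd_of_dvd_mul_left ?_
    have := dvd_sub (hu'.mul_left w) (hw.mul_left u)
    convert this using 1
    ring
  have habs : |u * (y₁ - y₀) - w * (y - y₀)| < p := by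
    rw [abs_lt]
    constructor
    · have h1 : w * (m * y) ≤ w * (p - 1) := mul_le_mul_of_nonneg_left (by omega) (by omega)
      have h2 : w * (p - 1) < m * p := by nlinarith
      have h3 : 0 ≤ m * (u * y₁ + (w - u) * y₀) := by
        have : 0 ≤ w - u := by omega
        positivity
      refine lt_of_mul_lt_mul_left (a := m) ?_ hm.le
      nlinarith
    · have h1 : u * (m * y₁) ≤ u * (p - 1) := mul_le_mul_of_nonneg_left (by omega) hu
      have h2 : (w - u) * (m * y₀) ≤ (w - u) * (p - 1) :=
        mul_le_mul_of_nonneg_left (by omega) (by omega)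
      have h3 : w * (p - 1) < m * p := by nlinarith
      have h4 : 0 ≤ m * (w * y) := by
        have : 0 ≤ w := by omega
        positivity
      refine lt_of_mul_lt_mul_left (a := m) ?_ hm.le
      nlinarith
  have := Int.eq_zero_of_abs_lt_dvd hdvd habs
  omega

/-- If `s + 1` elements of `[m]` fall into one bin of `x ↦ (A·x + B) mod p mod m`, then the
lattice `{(d, e) : A·d ≡ m·e (mod p)}` has a vector which is short by a factor `s` in both
coordinates. -/
theorem exists_short_vector_s10 {p m s A i : ℕ} {f : ℕ → ℕ} {X : Finset ℕ} (hcop : Nat.Coprime p m)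
    (hp : 0 < p) (hm : 0 < m) (hs : 1 ≤ s) (hX : s + 1 ≤ X.card) (hXm : ∀ x ∈ X, x < m)
    (hfp : ∀ x, f x < p) (hf : ∀ x y : ℕ, (p : ℤ) ∣ A * ((x : ℤ) - y) - ((f x : ℤ) - f y))
    (hi : ∀ x ∈ X, f x % m = i) :
    ∃ d : ℕ, ∃ e : ℤ, 1 ≤ d ∧ d * s < m ∧ |e| * (m * s) < p ∧ (p : ℤ) ∣ A * d - m * e := by
  have hne : X.Nonempty := Finset.card_pos.mp (by omega)
  set lo := X.min' hne
  set hi' := X.max' hne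
  have hloX : lo ∈ X := X.min'_mem hne
  have hhiX : hi' ∈ X := X.max'_mem hne
  have hlo : ∀ x ∈ X, lo ≤ x := fun x hx => X.min'_le x hx
  have hhi : ∀ x ∈ X, x ≤ hi' := fun x hx => X.le_max' x hx
  obtain ⟨x, hx, y, hy, hxy, hgap⟩ := exists_small_gap hs hX hlo hhi
  let g : ℕ → ℤ := fun x => ((f x / m : ℕ) : ℤ)
  have hg0 : ∀ x, 0 ≤ g x := fun x => Int.natCast_nonneg _
  have hfg : ∀ x ∈ X, (f x : ℤ) = m * g x + i := by
    intro x hx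
    have := Nat.div_add_mod (f x) m
    rw [hi x hx] at this
    have h2 : ((m * (f x / m) + i : ℕ) : ℤ) = f x := congrArg _ this
    rw [← h2, Nat.cast_add, Nat.cast_mul]
  have hgp : ∀ x ∈ X, (m : ℤ) * g x < p := by
    intro x hx
    have h1 := hfg x hx
    have h2 := hfp x
    omega
  have hdvd : ∀ x ∈ X, ∀ y ∈ X, (p : ℤ) ∣ A * ((x : ℤ) - y) - m * (g x - g y) := by
    intro x hx y hy
    have := hf x y
    rw [hfg x hx, hfg y hy] at this
    convert this using 1
    ring
  have hcol : ∀ x ∈ X, ((x : ℤ) - lo) * (g hi' - g lo) = ((hi' : ℤ) - lo) * (g x - g lo) := by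
    intro x hx
    have h1 := hlo x hx
    have h2 := hhi x hx
    have h3 := hXm _ hhiX
    exact collinear_of_lattice_box (Nat.isCoprime_iff_coprime.mpr hcop)
      (by exact_mod_cast hp) (by exact_mod_cast hm) (by omega) (by omega) (by omega) (hg0 _)
      (hg0 _) (hg0 _) (hgp _ hloX) (hgp _ hhiX) (hgp _ hx) (hdvd _ hhiX _ hloX) (hdvd _ hx _ hloX)
  have hlh : lo < hi' := (hlo x hx).trans_lt (hxy.trans_le (hhi y hy))
  refine ⟨y - x, g y - g x, by omega, ?_, ?_, ?_⟩
  · have := hXm _ hhiX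
    omega
  · have hw : (0 : ℤ) < (hi' : ℤ) - lo := by omega
    have heq : ((y : ℤ) - x) * (g hi' - g lo) = ((hi' : ℤ) - lo) * (g y - g x) := by
      linear_combination hcol y hy - hcol x hx
    have habs : ((y : ℤ) - x) * |g hi' - g lo| = ((hi' : ℤ) - lo) * |g y - g x| := by
      have := congrArg abs heq
      rwa [abs_mul, abs_mul, abs_of_pos hw, abs_of_pos (by omega : (0 : ℤ) < (y : ℤ) - x)] at this
    have hgap' : ((y : ℤ) - x) * s ≤ (hi' : ℤ) - lo := by
      have : (((y - x) * s : ℕ) : ℤ) ≤ ((hi' - lo : ℕ) : ℤ) := by exact_mod_cast hgap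
      rwa [Nat.cast_mul, Nat.cast_sub hxy.le, Nat.cast_sub hlh.le] at this
    have hse : |g y - g x| * s ≤ |g hi' - g lo| := by
      refine le_of_mul_le_mul_left (a := (hi' : ℤ) - lo) ?_ hw
      calc ((hi' : ℤ) - lo) * (|g y - g x| * s) = (((y : ℤ) - x) * s) * |g hi' - g lo| := by
            linear_combination -(s : ℤ) * habs
        _ ≤ _ := mul_le_mul_of_nonneg_right hgap' (abs_nonneg _)
    have hΔ : m * |g hi' - g lo| < (p : ℤ) := by
      have h1 := hgp _ hhiX
      have h2 := hgp _ hloX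
      have hm' : (0 : ℤ) ≤ m := Int.natCast_nonneg m
      have h3 := mul_nonneg hm' (hg0 hi')
      have h4 := mul_nonneg hm' (hg0 lo)
      rcases abs_cases (g hi' - g lo) with ⟨h, -⟩ | ⟨h, -⟩ <;> rw [h] <;> linarith
    calc |g y - g x| * (m * s) = m * (|g y - g x| * s) := by ring
      _ ≤ m * |g hi' - g lo| := mul_le_mul_of_nonneg_left hse (Int.natCast_nonneg m)
      _ < p := hΔ
  · rw [Nat.cast_sub hxy.le]
    exact hdvd y hy x hx

/-- The multipliers `a ∈ [p]` for which the lattice `{(d, e) : a·α·d ≡ m·e (mod p)}` has a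
vector which is short by a factor `s` in both coordinates. -/
noncomputable def shortVectorMultipliers (p m α s : ℕ) : Finset ℕ :=
  (Finset.Icc 1 (m / s) ×ˢ Finset.Icc (-(p / (m * s) : ℕ) : ℤ) (p / (m * s) : ℕ)).biUnion fun q =>
    (Finset.range p).filter fun a => (p : ℤ) ∣ (a * α : ℕ) * q.1 - m * q.2

theorem mem_shortVectorMultipliers {p m α s a d : ℕ} {e : ℤ} (hm : 0 < m) (hs : 1 ≤ s)
    (ha : a < p) (hd : 1 ≤ d) (hds : d * s < m) (he : |e| * (m * s) < p)
    (h : (p : ℤ) ∣ (a * α : ℕ) * d - m * e) : a ∈ shortVectorMultipliers p m α s := by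
  have hle : |e| ≤ ((p / (m * s) : ℕ) : ℤ) := by
    rw [Int.natCast_div, Int.le_ediv_iff_mul_le (by positivity)]
    exact_mod_cast he.le
  rw [abs_le] at hle
  simp only [shortVectorMultipliers, Finset.mem_biUnion, Finset.mem_product, Finset.mem_Icc,
    Finset.mem_filter, Finset.mem_range]
  exact ⟨(d, e), ⟨⟨hd, (Nat.le_div_iff_mul_le hs).mpr hds.le⟩, hle⟩, ha, h⟩

theorem card_shortVectorMultipliers_mul_sq_le {p m α s : ℕ} (hp : p.Prime) (hm : m ^ 2 ≤ p)
    (hα : α < p) (hα0 : α ≠ 0) (hs : 1 ≤ s) (hsm : s < m) :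
    (shortVectorMultipliers p m α s).card * s ^ 2 ≤ 3 * p := by
  have hcard : (shortVectorMultipliers p m α s).card ≤ (m / s) * (2 * (p / (m * s)) + 1) := by
    have hIcc : (Finset.Icc (-(p / (m * s) : ℕ) : ℤ) (p / (m * s) : ℕ)).card
        = 2 * (p / (m * s)) + 1 := by
      rw [Int.card_Icc]
      omega
    refine (Finset.card_biUnion_le_card_mul _ _ 1 ?_).trans ?_
    · rintro ⟨d, e⟩ hq
      simp only [Finset.mem_product, Finset.mem_Icc] at hq
      obtain ⟨⟨hd, hdm⟩, -⟩ := hq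
      rw [Finset.card_le_one]
      intro a ha a' ha'
      simp only [Finset.mem_filter, Finset.mem_range] at ha ha'
      have hdp : d < p := by
        have := Nat.div_le_self m s
        nlinarith
      have hdvd : (p : ℤ) ∣ ((a : ℤ) - a') * ((α * d : ℕ) : ℤ) := by
        have := Int.dvd_sub ha.2 ha'.2
        convert this using 1
        push_cast
        ring
      have hnot : ¬ (p : ℤ) ∣ ((α * d : ℕ) : ℤ) := by
        rw [Int.natCast_dvd_natCast, hp.dvd_mul]
        rintro (h | h)
        · exact absurd (Nat.le_of_dvd (by omega) h) (by omega)
        · exact absurd (Nat.le_of_dvd (by omega) h) (by omega)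
      have hsub := ((Nat.prime_iff_prime_int.mp hp).dvd_or_dvd hdvd).resolve_right hnot
      have := Int.eq_zero_of_abs_lt_dvd hsub (by rw [abs_lt]; omega)
      omega
    · rw [Finset.card_product, hIcc, Nat.card_Icc, mul_one, Nat.add_sub_cancel]
  have h1 : m / s * s ≤ m := Nat.div_mul_le_self m s
  have h2 : p / (m * s) * (m * s) ≤ p := Nat.div_mul_le_self p (m * s)
  calc (shortVectorMultipliers p m α s).card * s ^ 2
      ≤ (m / s) * (2 * (p / (m * s)) + 1) * s ^ 2 := Nat.mul_le_mul_right _ hcard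
    _ = (m / s * s) * ((2 * (p / (m * s)) + 1) * s) := by ring
    _ ≤ m * ((2 * (p / (m * s)) + 1) * s) := Nat.mul_le_mul_right _ h1
    _ = 2 * (p / (m * s) * (m * s)) + m * s := by ring
    _ ≤ 3 * p := by nlinarith

/-- A bin with at least `s + 1` elements forces the multiplier to have a short vector. -/
theorem mem_shortVectorMultipliers_of_lt_maxBin {p m α β a b s : ℕ} (hcop : Nat.Coprime p m)
    (hp : 0 < p) (hm : 0 < m) (ha : a < p) (hs : 1 ≤ s)
    (h : s < maxBin m (hab p m a b) ((Finset.range m).image fun x => (α * x + β) % p)) :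
    a ∈ shortVectorMultipliers p m α s := by
  obtain ⟨i, -, hi⟩ := Finset.lt_sup_iff.mp h
  let f : ℕ → ℕ := fun x => (a * ((α * x + β) % p) + b) % p
  have hX : s + 1 ≤ ((Finset.range m).filter fun x => f x % m = i).card := by
    refine hi.trans_le ?_
    rw [binSize, Finset.filter_image]
    exact Finset.card_image_le
  have hf : ∀ x y : ℕ, (p : ℤ) ∣ (a * α : ℕ) * ((x : ℤ) - y) - ((f x : ℤ) - f y) := by
    have hmod : ∀ x : ℕ, (p : ℤ) ∣ (a * (α * x + β) + b) - (f x : ℤ) := by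
      intro x
      refine Int.ModEq.dvd ?_
      have : f x ≡ a * (α * x + β) + b [MOD p] :=
        (Nat.mod_modEq _ _).trans (((Nat.mod_modEq _ _).mul_left a).add_right b)
      exact_mod_cast (Int.natCast_modEq_iff.mpr this)
    intro x y
    convert Int.dvd_sub (hmod x) (hmod y) using 1
    push_cast
    ring
  obtain ⟨d, e, hd, hds, he, hdvd⟩ := exists_short_vector_s10 hcop hp hm hs hX
    (fun x hx => Finset.mem_range.mp (Finset.mem_filter.mp hx).1) (fun x => Nat.mod_lt _ hp) hf
    (fun x hx => (Finset.mem_filter.mp hx).2)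
  exact mem_shortVectorMultipliers hm hs ha hd hds he hdvd

theorem maxBin_le_card (m : ℕ) (h : ℕ → ℕ) (S : Finset ℕ) : maxBin m h S ≤ S.card :=
  Finset.sup_le fun _ _ => Finset.card_filter_le _ _

theorem maxBin_le_one_add_sum {p m α β a b : ℕ} (hcop : Nat.Coprime p m)
    (hp : 0 < p) (hm : 0 < m) (ha : a < p) :
    maxBin m (hab p m a b) ((Finset.range m).image fun x => (α * x + β) % p)
      ≤ 1 + ∑ s ∈ Finset.Ico 1 m, if a ∈ shortVectorMultipliers p m α s then 1 else 0 := by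
  have hL := (maxBin_le_card m (hab p m a b)
    ((Finset.range m).image fun x => (α * x + β) % p)).trans Finset.card_image_le
  rw [Finset.card_range] at hL
  rw [← Finset.card_filter]
  set L := maxBin m (hab p m a b) ((Finset.range m).image fun x => (α * x + β) % p) with hLdef
  have hsub : Finset.Ico 1 L ⊆
      (Finset.Ico 1 m).filter fun s => a ∈ shortVectorMultipliers p m α s := by
    intro s hs
    rw [Finset.mem_Ico] at hs
    rw [Finset.mem_filter, Finset.mem_Ico]
    exact ⟨⟨hs.1, hs.2.trans_le hL⟩,
      mem_shortVectorMultipliers_of_lt_maxBin hcop hp hm ha hs.1 (hLdef ▸ hs.2)⟩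
  have := Finset.card_le_card hsub
  rw [Nat.card_Ico] at this
  omega

theorem sum_Ico_one_inv_sq_le_two (m : ℕ) : ∑ s ∈ Finset.Ico 1 m, ((s : ℝ) ^ 2)⁻¹ ≤ 2 := by
  have h := sum_Ioo_inv_sq_le (α := ℝ) 0 m
  have heq : Finset.Ioo 0 m = Finset.Ico 1 m := by
    ext s
    simp only [Finset.mem_Ioo, Finset.mem_Ico]
    omega
  rw [heq] at h
  simpa using h

/-- For a fixed shift, the sum of the maximum bin sizes over all multipliers is at most `7p`. -/
theorem sum_maxBin_le {p m α β : ℕ} (b : ℕ) (hp : p.Prime) (hm : 0 < m) (hmp : m ^ 2 ≤ p)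
    (hα : α < p) (hα0 : α ≠ 0) :
    ∑ a ∈ Finset.range p, (maxBin m (hab p m a b)
      ((Finset.range m).image fun x => (α * x + β) % p) : ℝ) ≤ 7 * p := by
  have hlt : m < p := by
    have := hp.two_le
    nlinarith
  have hcop : Nat.Coprime p m := (Nat.coprime_of_lt_prime hm.ne' hlt hp)
  have hnat : ∑ a ∈ Finset.range p, maxBin m (hab p m a b)
      ((Finset.range m).image fun x => (α * x + β) % p)
      ≤ p + ∑ s ∈ Finset.Ico 1 m, (shortVectorMultipliers p m α s).card := by
    refine (Finset.sum_le_sum fun a ha =>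
      maxBin_le_one_add_sum hcop hp.pos hm (Finset.mem_range.mp ha)).trans ?_
    rw [Finset.sum_add_distrib, Finset.sum_comm]
    refine add_le_add (by simp) (Finset.sum_le_sum fun s _ => ?_)
    rw [← Finset.card_filter]
    exact Finset.card_le_card fun a ha => (Finset.mem_filter.mp ha).2
  have hcard : ∀ s ∈ Finset.Ico 1 m,
      ((shortVectorMultipliers p m α s).card : ℝ) ≤ 3 * p * ((s : ℝ) ^ 2)⁻¹ := by
    intro s hs
    rw [Finset.mem_Ico] at hs
    have hs0 : (0 : ℝ) < (s : ℝ) ^ 2 := by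
      have : (0 : ℝ) < s := by exact_mod_cast hs.1
      positivity
    rw [← div_eq_mul_inv, le_div_iff₀ hs0]
    exact_mod_cast card_shortVectorMultipliers_mul_sq_le hp hmp hα hα0 hs.1 hs.2
  calc ∑ a ∈ Finset.range p, (maxBin m (hab p m a b)
        ((Finset.range m).image fun x => (α * x + β) % p) : ℝ)
      ≤ p + ∑ s ∈ Finset.Ico 1 m, ((shortVectorMultipliers p m α s).card : ℝ) := by
        exact_mod_cast hnat
    _ ≤ p + ∑ s ∈ Finset.Ico 1 m, 3 * p * ((s : ℝ) ^ 2)⁻¹ := by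
        gcongr with s hs
        exact hcard s hs
    _ = p + 3 * p * ∑ s ∈ Finset.Ico 1 m, ((s : ℝ) ^ 2)⁻¹ := by rw [Finset.mul_sum]
    _ ≤ p + 3 * p * 2 := by
        gcongr
        exact sum_Ico_one_inv_sq_le_two m
    _ = 7 * p := by ring

/-- **Transformed intervals also have constant expected maximum load.**  There is an
absolute constant `C > 0` such that for every positive integer `m`, every prime
`p ≥ m²` and every `α, β ∈ [p]` with `α ≠ 0`, the expectation over a uniform pair
`(a, b) ∈ [p]²` of the maximum bin size of `S = {(α·x + β) mod p : x ∈ [m]}` under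
`h_{a,b}` is at most `C`. -/
theorem expected_maxBin_transformed_interval_constant :
    ∃ C : ℝ, 0 < C ∧ ∀ p m α β : ℕ, p.Prime → 0 < m → m ^ 2 ≤ p →
      α < p → β < p → α ≠ 0 →
      (∑ ab ∈ (Finset.range p) ×ˢ (Finset.range p),
          (maxBin m (hab p m ab.1 ab.2)
            ((Finset.range m).image (fun x => (α * x + β) % p)) : ℝ)) / (p : ℝ) ^ 2 ≤ C := by
  refine ⟨7, by norm_num, fun p m α β hp hm hmp hα _ hα0 => ?_⟩
  have hp0 : (0 : ℝ) < p := by exact_mod_cast hp.pos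
  rw [div_le_iff₀ (by positivity), Finset.sum_product_right]
  calc _ ≤ ∑ _b ∈ Finset.range p, (7 * p : ℝ) :=
        Finset.sum_le_sum fun b _ => sum_maxBin_le b hp hm hmp hα hα0
    _ = 7 * (p : ℝ) ^ 2 := by
        rw [Finset.sum_const, Finset.card_range, nsmul_eq_mul]
        ring
end

section
/- Let p be a prime, m a positive integer with m ≤ p, a, b ∈ [p], and d ∈ [p] with d ≥ 2. If h_{a,b}(0) = h_{a,b}(1) = h_{a,b}(d), then m divides a − l(1, a, b)·p and m divides d·l(1, a, b) − l(d, a, b), where l(x, a, b) = ⌊(a·x + b)/p⌋. -/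
/-- The leap count `l(x, a, b) = ⌊(a·x + b)/p⌋`. -/
def leap (p a b x : ℕ) : ℕ := (a * x + b) / p

/-- A collision of `x` with `0` forces `m ∣ a * x - l(x, a, b) * p`. -/
theorem dvd_mul_sub_leap_mul {p m a b x : ℕ} (hb : b < p)
    (h : hab p m a b 0 = hab p m a b x) :
    (m : ℤ) ∣ (a : ℤ) * x - (leap p a b x : ℤ) * p := by
  have hmod : b ≡ (a * x + b) % p [MOD m] := by
    simpa [hab, Nat.ModEq, Nat.mod_eq_of_lt hb] using h
  have hdiv : (p : ℤ) * (leap p a b x : ℤ) + ((a * x + b) % p : ℕ) = a * x + b := by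
    exact_mod_cast Nat.div_add_mod (a * x + b) p
  convert hmod.dvd using 1
  linarith

/-- **Divisibility conditions forced by a three-element collision.**  If
`h_{a,b}(0) = h_{a,b}(1) = h_{a,b}(d)` for `d ∈ [p]` with `d ≥ 2`, then
`m ∣ a − l(1,a,b)·p` and `m ∣ d·l(1,a,b) − l(d,a,b)` (as integers). -/
theorem collision_divisibility
    (p m a b d : ℕ) (hp : p.Prime) (hm : 0 < m) (hmp : m ≤ p)
    (ha : a < p) (hb : b < p) (hd : d < p) (hd2 : 2 ≤ d)
    (hcol : hab p m a b 0 = hab p m a b 1 ∧ hab p m a b 0 = hab p m a b d) :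
    (m : ℤ) ∣ (a : ℤ) - (leap p a b 1 : ℤ) * p ∧
      (m : ℤ) ∣ (d : ℤ) * (leap p a b 1 : ℤ) - (leap p a b d : ℤ) := by
  have h₁ : (m : ℤ) ∣ (a : ℤ) - (leap p a b 1 : ℤ) * p := by
    simpa using dvd_mul_sub_leap_mul hb hcol.1
  refine ⟨h₁, ?_⟩
  rcases hmp.eq_or_lt with rfl | hlt
  · have ha0 : a = 0 := by
      have hdvd : (m : ℤ) ∣ a := (dvd_sub_left (dvd_mul_left _ _)).mp h₁
      exact Nat.eq_zero_of_dvd_of_lt (Int.natCast_dvd_natCast.mp hdvd) ha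
    simp [leap, ha0, Nat.div_eq_of_lt hb]
  · have hcop : IsCoprime (m : ℤ) (p : ℤ) :=
      Nat.isCoprime_iff_coprime.mpr (Nat.coprime_of_lt_prime hm.ne' hlt hp).symm
    refine hcop.dvd_of_dvd_mul_right ?_
    convert (dvd_mul_sub_leap_mul hb hcol.2).sub (h₁.mul_left (d : ℤ)) using 1
    ring
end

section
/- Let p be a prime, m a positive integer with m ≤ p, and a ∈ [p] with a ≠ 0. If x₁ < x₂ are two elements of [m] = {0, ..., m−1} with h_{a,0}(x₁) = h_{a,0}(x₂), then, setting d = x₂ − x₁, either m divides (a·d) mod p, or m divides p − ((a·d) mod p). -/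
/-- **Collisions within `[m]` come from special differences.**  If `x₁ < x₂` are two
elements of `[m]` colliding under `h_{a,0}` with `a ≠ 0`, then for `d = x₂ − x₁`
either `m ∣ (a·d) mod p` or `m ∣ p − ((a·d) mod p)`. -/
theorem collision_difference_divisibility
    (p m a x₁ x₂ : ℕ) (hp : p.Prime) (hm : 0 < m) (hmp : m ≤ p)
    (ha : a < p) (ha0 : a ≠ 0) (hx₁ : x₁ < m) (hx₂ : x₂ < m) (hlt : x₁ < x₂)
    (hcol : hab p m a 0 x₁ = hab p m a 0 x₂) :
    m ∣ (a * (x₂ - x₁)) % p ∨ m ∣ p - (a * (x₂ - x₁)) % p := by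
  obtain ⟨d, rfl⟩ := Nat.exists_eq_add_of_lt hlt
  simp only [hab, add_zero] at hcol
  rw [show x₁ + d + 1 - x₁ = d + 1 by omega]
  rw [show a * (x₁ + d + 1) = a * x₁ + a * (d + 1) by ring, Nat.add_mod (a * x₁)] at hcol
  have hu := Nat.mod_lt (a * x₁) hp.pos
  have hw := Nat.mod_lt (a * (d + 1)) hp.pos
  generalize a * x₁ % p = u at *
  generalize a * (d + 1) % p = w at *
  rcases lt_or_ge (u + w) p with h | h
  · left
    rw [Nat.mod_eq_of_lt h] at hcol
    have key := (Nat.modEq_iff_dvd' (Nat.le_add_right u w)).mp hcol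
    rwa [Nat.add_sub_cancel_left] at key
  · right
    rw [Nat.mod_eq_sub_mod h, Nat.mod_eq_of_lt (a := u + w - p) (by omega)] at hcol
    have key := (Nat.modEq_iff_dvd' (show u + w - p ≤ u by omega)).mp hcol.symm
    rwa [show u - (u + w - p) = p - w by omega] at key
end
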